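/- For every m ≥ 1 and every LTL formula φ of temporal degree k (the maximal nesting depth of the operators N and U in φ), φ ∈ LTL_NT(m) if and only if φ is true at the point 0 in every model with uniform intransitivity m whose valuation assigns to each letter a subset of the initial segment {0, 1, …, (k+1)·m}; in particular, membership of φ in LTL_NT(m) is determined by checking φ on an initial part of the frame consisting of k+1 subsequent intervals of length m. -/

import Mathlib

/-- LTL formulas: letters, falsum, implication, Next, Until.
Other Boolean connectives are defined as abbreviations. -/
inductive Fml : Type
  | letter : ℕ → Fml
  | bot : Fml
  | imp : Fml → Fml → Fml
  | next : Fml → Fml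
  | untl : Fml → Fml → Fml
deriving DecidableEq

namespace Fml
def neg (φ : Fml) : Fml := imp φ bot
def top : Fml := neg bot
def conj (φ ψ : Fml) : Fml := neg (imp φ (neg ψ))
def disj (φ ψ : Fml) : Fml := imp (neg φ) ψ
/-- □φ abbreviates ¬(⊤ U ¬φ). -/
def box (φ : Fml) : Fml := neg (untl top (neg φ))
end Fml

/-- Truth in a model on the non-transitive linear frame determined by `t : ℕ → ℕ`:
`φ U ψ` at `a` looks only as far as `t a`. -/
def sat (t : ℕ → ℕ) (V : ℕ → Set ℕ) : Fml → ℕ → Prop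
  | .letter p, a => a ∈ V p
  | .bot, _ => False
  | .imp φ ψ, a => sat t V φ a → sat t V ψ a
  | .next φ, a => sat t V φ (a + 1)
  | .untl φ ψ, a => ∃ b, a ≤ b ∧ b ≤ t a ∧ sat t V ψ b ∧ ∀ c, a ≤ c → c < b → sat t V φ c

/-- A non-transitive linear frame: `t i > i` and `t` is increasing on successive points. -/
def NTFrame (t : ℕ → ℕ) : Prop := (∀ i, i < t i) ∧ (∀ i, t i < t (i + 1))

/-- The logic LTL_NT. -/
def LTLNT : Set Fml := {φ | ∀ t, NTFrame t → ∀ V a, sat t V φ a}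

/-- Standard LTL semantics on ⟨ℕ, ≤, Next⟩. -/
def satStd (V : ℕ → Set ℕ) : Fml → ℕ → Prop
  | .letter p, a => a ∈ V p
  | .bot, _ => False
  | .imp φ ψ, a => satStd V φ a → satStd V ψ a
  | .next φ, a => satStd V φ (a + 1)
  | .untl φ ψ, a => ∃ b, a ≤ b ∧ satStd V ψ b ∧ ∀ c, a ≤ c → c < b → satStd V φ c

/-- The standard linear temporal logic LTL. -/
def LTL : Set Fml := {φ | ∀ V a, satStd V φ a}

/-- The logic LTL_NT(m) of uniform intransitivity `m` (frame with `t i = i + m`). -/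
def LTLNTm (m : ℕ) : Set Fml := {φ | ∀ V a, sat (· + m) V φ a}

/-- An inference rule: a finite list of premises and a conclusion. -/
structure Rule where
  prem : List Fml
  concl : Fml

/-- A rule is valid in a model iff truth of all premises at all points implies
truth of the conclusion at all points. -/
def validInModel (t : ℕ → ℕ) (V : ℕ → Set ℕ) (r : Rule) : Prop :=
  (∀ φ ∈ r.prem, ∀ a, sat t V φ a) → ∀ a, sat t V r.concl a

/-- A rule is valid in a frame iff it is valid in every model on it. -/
def validInFrame (t : ℕ → ℕ) (r : Rule) : Prop := ∀ V, validInModel t V r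

/-- Size of a formula. -/
def Fml.size : Fml → ℕ
  | .letter _ => 1
  | .bot => 1
  | .imp φ ψ => φ.size + ψ.size + 1
  | .next φ => φ.size + 1
  | .untl φ ψ => φ.size + ψ.size + 1

/-- Size of a rule. -/
def Rule.size (r : Rule) : ℕ := (r.prem.map Fml.size).sum + r.concl.size

/-- An injective encoding of formulas into ℕ (to speak about computability). -/
def encF : Fml → ℕ
  | .letter p => Nat.pair 0 p
  | .bot => Nat.pair 1 0
  | .imp φ ψ => Nat.pair 2 (Nat.pair (encF φ) (encF ψ))
  | .next φ => Nat.pair 3 (encF φ)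
  | .untl φ ψ => Nat.pair 4 (Nat.pair (encF φ) (encF ψ))

def encL : List Fml → ℕ
  | [] => 0
  | φ :: l => Nat.pair (encF φ) (encL l) + 1

/-- An injective encoding of rules into ℕ. -/
def encRule (r : Rule) : ℕ := Nat.pair (encL r.prem) (encF r.concl)

/-- A literal: `φ` or `¬φ` according to a Boolean flag (`α⁰ = α`, `α¹ = ¬α`). -/
def lit (b : Bool) (φ : Fml) : Fml := if b then φ else φ.neg

/-- Conjunction of a list of formulas. -/
def bigConj : List Fml → Fml
  | [] => Fml.top
  | φ :: l => (bigConj l).conj φ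

/-- Disjunction of a list of formulas. -/
def bigDisj : List Fml → Fml
  | [] => Fml.bot
  | φ :: l => (bigDisj l).disj φ

/-- The premise of a rule in reduced normal form: a disjunction over `j < l` of
conjunctions of literals over `xᵢ`, `N xᵢ` (for `i < n`) and `xᵢ U x_k` (for `i ≠ k`). -/
def rnfPremise (n l : ℕ) (t0 t1 : Fin l → Fin n → Bool)
    (t2 : Fin l → Fin n → Fin n → Bool) : Fml :=
  bigDisj ((List.finRange l).map fun j =>
    bigConj ((List.finRange n).map (fun i => lit (t0 j i) (.letter i)) ++
      (List.finRange n).map (fun i => lit (t1 j i) (.next (.letter i))) ++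
      ((List.finRange n).flatMap fun i =>
        ((List.finRange n).filter (fun k => k ≠ i)).map fun k =>
          lit (t2 j i k) (.untl (.letter i) (.letter k))))) 

/-- `IsRNF n l r`: the rule `r` is in reduced normal form with `n` letters and
`l` disjuncts, i.e. of the shape `ε / x₁`. -/
def IsRNF (n l : ℕ) (r : Rule) : Prop :=
  0 < n ∧ 0 < l ∧ r.concl = .letter 0 ∧
    ∃ t0 t1 t2, r.prem = [rnfPremise n l t0 t1 t2]

/-- Next relation of the finite frame ℱ(N(r)): it wraps the last point `T` to `g`. -/
def wNext (T g : ℕ) (a : ℕ) : ℕ := if a = T then g else a + 1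

/-- Truth in a model on the finite frame `ℱ(N(r))` obtained from the frame of `t`:
the base set is `[0, t^[r+1] 0]`, `T = t^[r+1] 0` is the last point, whose `Next` is
`G = t^[g] 0`; `until` from `a` follows `wNext` for at most `t a - a` steps, so on the
last interval it acts as if the interval following it were `[t^[g] 0, t^[g+1] 0]`. -/
def satFin (t : ℕ → ℕ) (T G : ℕ) (V : ℕ → Set ℕ) : Fml → ℕ → Prop
  | .letter p, a => a ∈ V p
  | .bot, _ => False
  | .imp φ ψ, a => satFin t T G V φ a → satFin t T G V ψ a
  | .next φ, a => satFin t T G V φ (wNext T G a)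
  | .untl φ ψ, a => ∃ k, k ≤ t a - a ∧ satFin t T G V ψ ((wNext T G)^[k] a) ∧
      ∀ j < k, satFin t T G V φ ((wNext T G)^[j] a)

/-- `r` is refuted by `V` in the finite frame `ℱ(N(rr))` (with parameter `g`) built
from the frame of `t`: all premises hold at every point of the frame, while the
conclusion fails at some point. -/
def refutedFin (t : ℕ → ℕ) (rr g : ℕ) (V : ℕ → Set ℕ) (r : Rule) : Prop :=
  (∀ φ ∈ r.prem, ∀ a ≤ t^[rr + 1] 0, satFin t (t^[rr + 1] 0) (t^[g] 0) V φ a) ∧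
    ∃ a ≤ t^[rr + 1] 0, ¬ satFin t (t^[rr + 1] 0) (t^[g] 0) V r.concl a

/-- Temporal degree: maximal nesting depth of `N` and `U`. -/
def tdeg : Fml → ℕ
  | .letter _ => 0
  | .bot => 0
  | .imp φ ψ => max (tdeg φ) (tdeg ψ)
  | .next φ => tdeg φ + 1
  | .untl φ ψ => max (tdeg φ) (tdeg ψ) + 1

/-- `i`-fold application of `N`. -/
def nPow : ℕ → Fml → Fml
  | 0, φ => φ
  | k + 1, φ => .next (nPow k φ)

/-- Substitution of formulas for letters. -/
def subst (σ : ℕ → Fml) : Fml → Fml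
  | .letter p => σ p
  | .bot => .bot
  | .imp φ ψ => .imp (subst σ φ) (subst σ ψ)
  | .next φ => .next (subst σ φ)
  | .untl φ ψ => .untl (subst σ φ) (subst σ ψ)

/-- A rule is admissible in a logic `L` iff every substitution making all premises
theorems of `L` makes the conclusion a theorem of `L`. -/
def Admissible (L : Set Fml) (r : Rule) : Prop :=
  ∀ σ : ℕ → Fml, (∀ φ ∈ r.prem, subst σ φ ∈ L) → subst σ r.concl ∈ L

/-- Truth at a point depends only on the next `tdeg φ * m` points, up to shift. -/
theorem sat_shift (m : ℕ) (hm : 1 ≤ m) (V W : ℕ → Set ℕ) (φ : Fml) :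
    ∀ (a b n : ℕ), tdeg φ * m ≤ n → (∀ p, ∀ i ≤ n, (a + i ∈ V p ↔ b + i ∈ W p)) →
      (sat (· + m) V φ a ↔ sat (· + m) W φ b) := by
  induction φ with
  | letter p => intro a b n _ h; simpa [sat] using h p 0 (Nat.zero_le _)
  | bot => intro a b n _ _; simp [sat]
  | imp φ ψ ih1 ih2 =>
    intro a b n hn h
    have h1 : tdeg φ * m ≤ n :=
      le_trans (Nat.mul_le_mul_right m (le_max_left _ _)) hn
    have h2 : tdeg ψ * m ≤ n :=
      le_trans (Nat.mul_le_mul_right m (le_max_right _ _)) hn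
    simp only [sat]
    rw [ih1 a b n h1 h, ih2 a b n h2 h]
  | next φ ih =>
    intro a b n hn h
    simp only [tdeg, Nat.add_mul] at hn
    simp only [sat]
    refine ih (a + 1) (b + 1) (n - m) (by omega) ?_
    intro p i hi
    have := h p (1 + i) (by omega)
    simpa [Nat.add_assoc] using this
  | untl φ ψ ih1 ih2 =>
    intro a b n hn h
    simp only [tdeg, Nat.add_mul] at hn
    have h1 := Nat.mul_le_mul_right m (le_max_left (tdeg φ) (tdeg ψ))
    have h2 := Nat.mul_le_mul_right m (le_max_right (tdeg φ) (tdeg ψ))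
    have hh : ∀ j ≤ m, ∀ p, ∀ i ≤ n - m, (a + j + i ∈ V p ↔ b + j + i ∈ W p) := by
      intro j hj p i hi
      have := h p (j + i) (by omega)
      simpa [Nat.add_assoc] using this
    have e1 : ∀ j ≤ m, (sat (· + m) V φ (a + j) ↔ sat (· + m) W φ (b + j)) := fun j hj =>
      ih1 (a + j) (b + j) (n - m) (by omega) (hh j hj)
    have e2 : ∀ j ≤ m, (sat (· + m) V ψ (a + j) ↔ sat (· + m) W ψ (b + j)) := fun j hj =>
      ih2 (a + j) (b + j) (n - m) (by omega) (hh j hj)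
    simp only [sat]
    constructor
    · rintro ⟨x, hx, hxm, hs, hc⟩
      obtain ⟨j, rfl⟩ := Nat.exists_eq_add_of_le hx
      refine ⟨b + j, by omega, by omega, (e2 j (by omega)).1 hs, ?_⟩
      intro c hc1 hc2
      obtain ⟨i, rfl⟩ := Nat.exists_eq_add_of_le hc1
      exact (e1 i (by omega)).1 (hc (a + i) (by omega) (by omega))
    · rintro ⟨x, hx, hxm, hs, hc⟩
      obtain ⟨j, rfl⟩ := Nat.exists_eq_add_of_le hx
      refine ⟨a + j, by omega, by omega, (e2 j (by omega)).2 hs, ?_⟩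
      intro c hc1 hc2
      obtain ⟨i, rfl⟩ := Nat.exists_eq_add_of_le hc1
      exact (e1 i (by omega)).2 (hc (b + i) (by omega) (by omega))

/-- for m ≥ 1 and φ of temporal degree k, φ ∈ LTL_NT(m) iff φ is
true at 0 in every model with uniform intransitivity m whose valuation assigns
to each letter a subset of {0, …, (k+1)·m}. -/
theorem stmt7 (m : ℕ) (hm : 1 ≤ m) (φ : Fml) :
    φ ∈ LTLNTm m ↔
      ∀ V : ℕ → Set ℕ,
        (∀ p, V p ⊆ Set.Iic ((tdeg φ + 1) * m)) → sat (· + m) V φ 0 := by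
  constructor
  · intro h V _
    exact h V 0
  · intro h V a
    have := h (fun p => {i | a + i ∈ V p ∧ i ≤ (tdeg φ + 1) * m}) (fun p i hi => hi.2)
    refine (sat_shift m hm V _ φ a 0 ((tdeg φ + 1) * m)
      (Nat.mul_le_mul_right m (Nat.le_succ _)) ?_).2 this
    intro p i hi
    simp [hi]
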